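/- Let σx = [[0,1],[1,0]] and σz = [[1,0],[0,−1]] be Pauli matrices over ℂ, let Φ be the 4×4 projector onto (|00⟩+|11⟩)/√2, and W(v) = v·Φ + (1−v)·I₄/4. Define A_x = (σz + (−1)^x σx)/√2, B₀ = σz ⊗ σz, B₁ = σx ⊗ σx, F_x = A_x ⊗ A_x, G₀ = σz, G₁ = σx. Then for all v₁, v₂, v₃ ∈ ℝ and all x¹, x², x³, x⁴ ∈ {0,1}, the trace of the 64×64 matrix (W(v₁) ⊗ W(v₂) ⊗ W(v₃)) · (A_{x¹} ⊗ B_{x²} ⊗ F_{x³} ⊗ G_{x⁴}) equals (−1)^{x¹x² + x²x³ + x³x⁴} · v₁v₂v₃/(2√2). -/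

import Mathlib

open Matrix Kronecker

namespace Stmt16

noncomputable section

/-- The Pauli matrix `σx`. -/
def σx : Matrix (Fin 2) (Fin 2) ℂ := !![0, 1; 1, 0]

/-- The Pauli matrix `σz`. -/
def σz : Matrix (Fin 2) (Fin 2) ℂ := !![1, 0; 0, -1]

/-- The 4×4 projector `Φ` onto `(|00⟩+|11⟩)/√2`. -/
def Φ : Matrix (Fin 2 × Fin 2) (Fin 2 × Fin 2) ℂ :=
  Matrix.of fun p q => if p.1 = p.2 ∧ q.1 = q.2 then (1/2 : ℂ) else 0

/-- The two-qubit Werner state `W(v) = v·Φ + (1−v)·I₄/4`. -/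
def W (v : ℝ) : Matrix (Fin 2 × Fin 2) (Fin 2 × Fin 2) ℂ :=
  (v : ℂ) • Φ + ((1 - v : ℝ) : ℂ) • ((4 : ℂ)⁻¹ • (1 : Matrix (Fin 2 × Fin 2) (Fin 2 × Fin 2) ℂ))

/-- The measurement `A_x = (σz + (−1)^x σx)/√2`. -/
def A (x : Fin 2) : Matrix (Fin 2) (Fin 2) ℂ :=
  ((Real.sqrt 2 : ℂ))⁻¹ • (σz + ((-1 : ℂ) ^ (x : ℕ)) • σx)

/-- The measurement `B₀ = σz ⊗ σz`, `B₁ = σx ⊗ σx`. -/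
def B (x : Fin 2) : Matrix (Fin 2 × Fin 2) (Fin 2 × Fin 2) ℂ :=
  if x = 0 then σz ⊗ₖ σz else σx ⊗ₖ σx

/-- The measurement `F_x = A_x ⊗ A_x`. -/
def F (x : Fin 2) : Matrix (Fin 2 × Fin 2) (Fin 2 × Fin 2) ℂ := A x ⊗ₖ A x

/-- The measurement `G₀ = σz`, `G₁ = σx`. -/
def G (x : Fin 2) : Matrix (Fin 2) (Fin 2) ℂ := if x = 0 then σz else σx

/-- Canonical identification `((q1,q2),((q3,q4),(q5,q6))) ≃ (q1,(q2,(q3,(q4,(q5,q6)))))` of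
the 64-dimensional index sets (associativity of the Kronecker product), state side. -/
def eL : (Fin 2 × Fin 2) × (Fin 2 × Fin 2) × (Fin 2 × Fin 2)
    ≃ Fin 2 × Fin 2 × Fin 2 × Fin 2 × Fin 2 × Fin 2 :=
  (Equiv.prodAssoc (Fin 2) (Fin 2) ((Fin 2 × Fin 2) × (Fin 2 × Fin 2))).trans
    ((Equiv.refl (Fin 2)).prodCongr
      ((Equiv.refl (Fin 2)).prodCongr (Equiv.prodAssoc (Fin 2) (Fin 2) (Fin 2 × Fin 2))))

/-- Canonical identification `(q1,((q2,q3),((q4,q5),q6))) ≃ (q1,(q2,(q3,(q4,(q5,q6)))))`,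
measurement side. -/
def eR : Fin 2 × (Fin 2 × Fin 2) × (Fin 2 × Fin 2) × Fin 2
    ≃ Fin 2 × Fin 2 × Fin 2 × Fin 2 × Fin 2 × Fin 2 :=
  (Equiv.refl (Fin 2)).prodCongr
    ((Equiv.prodAssoc (Fin 2) (Fin 2) ((Fin 2 × Fin 2) × Fin 2)).trans
      ((Equiv.refl (Fin 2)).prodCongr
        ((Equiv.refl (Fin 2)).prodCongr (Equiv.prodAssoc (Fin 2) (Fin 2) (Fin 2)))))

/-- Expectation of a product observable in the Werner state. -/
lemma trace_W_mul_kronecker (v : ℝ) (M N : Matrix (Fin 2) (Fin 2) ℂ) :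
    trace (W v * (M ⊗ₖ N))
      = (v : ℂ) / 2 * trace (M * Nᵀ) + (1 - (v : ℂ)) / 4 * (trace M * trace N) := by
  have hΦ : trace (Φ * (M ⊗ₖ N)) = 1 / 2 * trace (M * Nᵀ) := by
    simp [trace, Matrix.mul_apply, Φ, Fintype.sum_prod_type, Fin.sum_univ_two]
    ring
  rw [W, add_mul, trace_add, smul_mul_assoc, smul_mul_assoc, smul_mul_assoc, one_mul,
    trace_smul, trace_smul, trace_smul, hΦ, trace_kronecker]
  push_cast
  simp only [smul_eq_mul]
  ring

lemma trace_G (x : Fin 2) : trace (G x) = 0 := by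
  fin_cases x <;> simp [G, σz, σx, trace, Fin.sum_univ_two]

lemma transpose_G (x : Fin 2) : (G x)ᵀ = G x := by
  fin_cases x <;> ext i j <;> fin_cases i <;> fin_cases j <;> simp [G, σz, σx]

lemma transpose_A (x : Fin 2) : (A x)ᵀ = A x := by
  ext i j
  fin_cases i <;> fin_cases j <;> simp [A, σz, σx]

lemma trace_A_mul_G (x y : Fin 2) :
    trace (A x * G y) = (-1 : ℂ) ^ ((x : ℕ) * (y : ℕ)) * (2 * (Real.sqrt 2 : ℂ)⁻¹) := by
  fin_cases x <;> fin_cases y <;>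
    simp [A, G, σz, σx, trace, Fin.sum_univ_two] <;> ring

lemma trace_W_mul_A_kronecker_G (v : ℝ) (x y : Fin 2) :
    trace (W v * (A x ⊗ₖ G y))
      = (-1 : ℂ) ^ ((x : ℕ) * (y : ℕ)) * ((v : ℂ) * (Real.sqrt 2 : ℂ)⁻¹) := by
  rw [trace_W_mul_kronecker, transpose_G, trace_G, trace_A_mul_G]
  ring

lemma trace_W_mul_G_kronecker_A (v : ℝ) (x y : Fin 2) :
    trace (W v * (G x ⊗ₖ A y))
      = (-1 : ℂ) ^ ((x : ℕ) * (y : ℕ)) * ((v : ℂ) * (Real.sqrt 2 : ℂ)⁻¹) := by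
  rw [trace_W_mul_kronecker, transpose_A, trace_G, trace_mul_comm, trace_A_mul_G,
    mul_comm (y : ℕ)]
  ring

lemma B_eq (x : Fin 2) : B x = G x ⊗ₖ G x := by
  by_cases h : x = 0 <;> simp [B, G, h]

lemma trace_submatrix_equiv_self {m n R : Type*} [Fintype m] [Fintype n] [AddCommMonoid R]
    (M : Matrix n n R) (e : m ≃ n) : trace (M.submatrix e e) = trace M :=
  e.sum_comp fun i => M i i

/-- Regrouping of six single-qubit operators from the parties to the sources. -/
lemma reindex_eR_kronecker (M₁ M₂ M₃ M₄ M₅ M₆ : Matrix (Fin 2) (Fin 2) ℂ) :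
    reindex eR eR (M₁ ⊗ₖ ((M₂ ⊗ₖ M₃) ⊗ₖ ((M₄ ⊗ₖ M₅) ⊗ₖ M₆)))
      = reindex eL eL ((M₁ ⊗ₖ M₂) ⊗ₖ ((M₃ ⊗ₖ M₄) ⊗ₖ (M₅ ⊗ₖ M₆))) := by
  ext ⟨a₁, a₂, a₃, a₄, a₅, a₆⟩ ⟨b₁, b₂, b₃, b₄, b₅, b₆⟩
  simp [eL, eR, kroneckerMap_apply, mul_assoc]

/-- For all `v₁, v₂, v₃ ∈ ℝ` and all `x¹, x², x³, x⁴ ∈ {0,1}`, the trace of the 64×64 matrix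
`(W(v₁) ⊗ W(v₂) ⊗ W(v₃)) · (A_{x¹} ⊗ B_{x²} ⊗ F_{x³} ⊗ G_{x⁴})` equals
`(−1)^{x¹x² + x²x³ + x³x⁴} · v₁v₂v₃/(2√2)`. -/
theorem trace_three_werner_chain (v₁ v₂ v₃ : ℝ) (x1 x2 x3 x4 : Fin 2) :
    Matrix.trace
      ((Matrix.reindex eL eL (W v₁ ⊗ₖ (W v₂ ⊗ₖ W v₃)))
        * (Matrix.reindex eR eR (A x1 ⊗ₖ (B x2 ⊗ₖ (F x3 ⊗ₖ G x4)))))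
      = ((-1 : ℂ) ^ ((x1 : ℕ) * (x2 : ℕ) + (x2 : ℕ) * (x3 : ℕ) + (x3 : ℕ) * (x4 : ℕ)))
          * ((v₁ * v₂ * v₃ / (2 * Real.sqrt 2) : ℝ) : ℂ) := by
  rw [B_eq, F, reindex_eR_kronecker, reindex_apply, reindex_apply, submatrix_mul_equiv,
    ← mul_kronecker_mul, ← mul_kronecker_mul, trace_submatrix_equiv_self, trace_kronecker,
    trace_kronecker, trace_W_mul_A_kronecker_G, trace_W_mul_G_kronecker_A,
    trace_W_mul_A_kronecker_G]
  have hsq : (Real.sqrt 2 : ℂ) ^ 2 = 2 := by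
    exact_mod_cast Real.sq_sqrt (by norm_num : (0 : ℝ) ≤ 2)
  have hinv : ((Real.sqrt 2 : ℂ)⁻¹) ^ 2 = 2⁻¹ := by rw [inv_pow, hsq]
  push_cast
  rw [pow_add, pow_add, div_eq_mul_inv, mul_inv, ← hinv]
  ring

end

end Stmt16
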